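/- Let m ≥ 0, l ≥ 1, n ≥ 4 with n − 2 = 2q + 1 odd, and r = gcd(l, m). The reduced Laplacian of the m-cone of the cycle C_n with all edges of multiplicity l is the n×n integer matrix C_n(m+2l, −l) with diagonal entries m+2l and entries −l in positions (i,j) with i − j ≡ ±1 (mod n). Let s_q be the integer with r^{q+1}·s_q = f_{q+1}(m+2l, −l) + l·f_q(m+2l, −l) (this divisibility holds). Then the critical group K(c_m(C_n(l))) = ℤⁿ / C_n(m+2l, −l)ᵀ ℤⁿ is isomorphic to (ℤ_r)^{n−2} ⊕ ℤ_{r·s_q} ⊕ ℤ_{m·s_q}. -/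

import Mathlib

open Matrix

/-- The sequence `f_n(x,y)` with `f_0 = 1`, `f_1 = x`,
`f_n = x·f_{n-1} - y²·f_{n-2}`. -/
def fseq {A : Type*} [CommRing A] (x y : A) : ℕ → A
  | 0 => 1
  | 1 => x
  | n + 2 => x * fseq x y (n + 1) - y ^ 2 * fseq x y n

/-- The matrix `C_n(a,b) = a·I_n + b·A(C_n)` where `A(C_n)` is the adjacency
matrix of the `n`-cycle.  For `a = m + 2l`, `b = -l` this is the reduced
Laplacian of the `m`-cone of the cycle `C_n` with all edges of
multiplicity `l`. -/
def Cmat {A : Type*} [CommRing A] (n : ℕ) (a b : A) : Matrix (Fin n) (Fin n) A :=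
  Matrix.of fun i j =>
    if i = j then a
    else if (i.val + 1) % n = j.val ∨ (j.val + 1) % n = i.val then b
    else 0

/-- If `φ : ℤⁿ → ℤ²` is surjective and `N` is the preimage of `d₁ℤ × d₂ℤ`, then
`ℤⁿ / rN ≅ (ℤ_r)^(n-2) ⊕ ℤ_{r·d₁} ⊕ ℤ_{r·d₂}`. -/
theorem nonempty_quotient_smul_addEquiv {n r : ℕ} {d₁ d₂ : ℤ}
    (φ : (Fin n → ℤ) →ₗ[ℤ] ℤ × ℤ) (hφ : Function.Surjective φ)
    (N N' : Submodule ℤ (Fin n → ℤ)) (hN : ∀ v, v ∈ N ↔ d₁ ∣ (φ v).1 ∧ d₂ ∣ (φ v).2)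
    (hN' : ∀ v, v ∈ N' ↔ ∃ w ∈ N, v = (r : ℤ) • w) :
    Nonempty (((Fin n → ℤ) ⧸ N') ≃+
      ((Fin (n - 2) → ZMod r) × ZMod ((r * d₁).natAbs) × ZMod ((r * d₂).natAbs))) := by
  obtain ⟨g, hg⟩ := Module.projective_lifting_property φ LinearMap.id hφ
  have hφg (y) : φ (g y) = y := LinearMap.congr_fun hg y
  have hrank : Module.finrank ℤ (LinearMap.ker φ) = n - 2 := by
    have h := (LinearMap.ker φ).finrank_quotient_add_finrank
    rw [(φ.quotKerEquivOfSurjective hφ).finrank_eq] at h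
    simp at h
    omega
  let b : LinearMap.ker φ ≃ₗ[ℤ] (Fin (n - 2) → ℤ) :=
    (Module.finBasisOfFinrankEq ℤ (LinearMap.ker φ) hrank).equivFun
  let π : (Fin n → ℤ) →ₗ[ℤ] LinearMap.ker φ :=
    (LinearMap.id - g ∘ₗ φ).codRestrict _ fun v => by simp [hφg]
  have hπ (v) : (π v : Fin n → ℤ) + g (φ v) = v := by simp [π]
  have hπ' (k : LinearMap.ker φ) (y) : π (k + g y) = k := by
    ext1
    have hk : φ k = 0 := k.2
    simp [π, hk, hφg]
  have hφ' (k : LinearMap.ker φ) (y) : φ (k + g y) = y := by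
    have hk : φ k = 0 := k.2
    simp [hk, hφg]
  let Θ : (Fin n → ℤ) →+
      ((Fin (n - 2) → ZMod r) × ZMod ((r * d₁).natAbs) × ZMod ((r * d₂).natAbs)) :=
    { toFun v := (fun i => (b (π v) i : ZMod r), ((φ v).1 : ZMod _), ((φ v).2 : ZMod _))
      map_zero' := by ext <;> simp
      map_add' v w := by ext <;> simp }
  have hΘ : Function.Surjective Θ.toIntLinearMap := by
    rintro ⟨k, y₁, y₂⟩
    choose k' hk' using fun i => ZMod.intCast_surjective (k i)
    obtain ⟨z₁, rfl⟩ := ZMod.intCast_surjective y₁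
    obtain ⟨z₂, rfl⟩ := ZMod.intCast_surjective y₂
    refine ⟨b.symm k' + g (z₁, z₂), ?_⟩
    simp only [AddMonoidHom.coe_toIntLinearMap, AddMonoidHom.coe_mk, ZeroHom.coe_mk, Θ, hπ', hφ',
      LinearEquiv.apply_symm_apply, hk']
  have hker : N' = LinearMap.ker Θ.toIntLinearMap := by
    ext v
    have hmem : v ∈ LinearMap.ker Θ.toIntLinearMap ↔
        (∀ i, (r : ℤ) ∣ b (π v) i) ∧ r * d₁ ∣ (φ v).1 ∧ r * d₂ ∣ (φ v).2 := by
      rw [LinearMap.mem_ker]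
      simp only [Θ, AddMonoidHom.coe_toIntLinearMap, AddMonoidHom.coe_mk, ZeroHom.coe_mk,
        Prod.mk_eq_zero, funext_iff, Pi.zero_apply, CharP.intCast_eq_zero_iff (ZMod r) r,
        CharP.intCast_eq_zero_iff (ZMod (r * d₁).natAbs) (r * d₁).natAbs,
        CharP.intCast_eq_zero_iff (ZMod (r * d₂).natAbs) (r * d₂).natAbs, Int.natAbs_dvd]
    rw [hN', hmem]
    constructor
    · rintro ⟨w, hw, rfl⟩
      obtain ⟨h₁, h₂⟩ := (hN w).1 hw
      simp only [map_smul, Pi.smul_apply, smul_eq_mul, Prod.smul_fst, Prod.smul_snd]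
      exact ⟨fun i => dvd_mul_right _ _, mul_dvd_mul_left _ h₁, mul_dvd_mul_left _ h₂⟩
    · rintro ⟨hk, ⟨α, hα⟩, ⟨β, hβ⟩⟩
      choose k hk using hk
      refine ⟨b.symm k + g (d₁ * α, d₂ * β), ?_, ?_⟩
      · rw [hN, hφ']
        exact ⟨dvd_mul_right _ _, dvd_mul_right _ _⟩
      · have h₁ : π v = (r : ℤ) • b.symm k := by
          apply b.injective
          ext i
          simp [hk]
        have h₂ : φ v = (r : ℤ) • (d₁ * α, d₂ * β) := by
          ext <;> simp [hα, hβ, mul_assoc]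
        rw [smul_add, ← map_smul g, ← h₂, ← Submodule.coe_smul, ← h₁, hπ]
  exact ⟨((Submodule.quotEquivOfEq _ _ hker).trans
    (Θ.toIntLinearMap.quotKerEquivOfSurjective hΘ)).toAddEquiv⟩

theorem fseq_mul_mul {A : Type*} [CommRing A] (r x y : A) (k : ℕ) :
    fseq (r * x) (r * y) k = r ^ k * fseq x y k := by
  induction k using Nat.twoStepInduction with
  | zero => simp [fseq]
  | one => simp [fseq]
  | more k h₁ h₂ => rw [fseq, fseq, h₁, h₂]; ring

theorem dvd_fseq_sub_pow {A : Type*} [CommRing A] (x y : A) (k : ℕ) :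
    y ∣ fseq x y k - x ^ k := by
  induction k using Nat.twoStepInduction with
  | zero => simp [fseq]
  | one => simp [fseq]
  | more k _ h =>
    obtain ⟨c, hc⟩ := h
    exact ⟨x * c - y * fseq x y k, by rw [fseq]; linear_combination x * hc⟩

theorem intCast_fseq {A : Type*} [CommRing A] (x y : ℤ) (k : ℕ) :
    ((fseq x y k : ℤ) : A) = fseq (x : A) (y : A) k := by
  induction k using Nat.twoStepInduction with
  | zero => simp [fseq]
  | one => simp [fseq]
  | more k h₁ h₂ => rw [fseq, fseq, ← h₁, ← h₂]; push_cast; ring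

theorem fseq_add_mul_fseq_mul_pow_mul {A : Type*} [CommRing A] {x a l : A}
    (h : l * x ^ 2 - a * x + l = 0) (k : ℕ) :
    (fseq a (-l) (k + 1) + l * fseq a (-l) k) * (x ^ (k + 1) * (x - 1)) =
      l ^ (k + 1) * (x ^ (2 * k + 3) - 1) := by
  induction k using Nat.twoStepInduction with
  | zero =>
    simp only [fseq]
    linear_combination (-(x - 1)) * h
  | one =>
    simp only [fseq]
    linear_combination (-(x - 1)) * ((a + l) * x + l + l * x ^ 2) * h
  | more k h₁ h₂ =>
    have h₃ : fseq a (-l) (k + 2) = a * fseq a (-l) (k + 1) - (-l) ^ 2 * fseq a (-l) k := rfl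
    rw [show k + 2 + 1 = (k + 1) + 2 from rfl, fseq, fseq]
    linear_combination (l * x ^ 2 + l) * h₂ - l ^ 2 * x ^ 2 * h₁ -
      (fseq a (-l) (k + 2) + l * fseq a (-l) (k + 1)) * (x ^ (k + 2) * (x - 1)) * h +
      a * x ^ (k + 3) * (1 - x) * h₃

theorem isCoprime_mul_fseq_add {m l : ℤ} (h : IsCoprime l m) (q : ℕ) :
    IsCoprime l (m * (fseq (m + 2 * l) (-l) (q + 1) + l * fseq (m + 2 * l) (-l) q)) := by
  refine h.mul_right ?_
  obtain ⟨c, hc⟩ := dvd_fseq_sub_pow (m + 2 * l) (-l) (q + 1)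
  have h₁ : IsCoprime l ((m + l * 2) ^ (q + 1)) := (h.add_mul_left_right 2).pow_right
  have h₂ : fseq (m + 2 * l) (-l) (q + 1) + l * fseq (m + 2 * l) (-l) q =
      (m + l * 2) ^ (q + 1) + l * (fseq (m + 2 * l) (-l) q - c) := by
    rw [mul_comm l 2]
    linear_combination hc
  exact h₂ ▸ h₁.add_mul_left_right _

open Polynomial in
/-- The linear map `ℤ[X] → ℤⁿ` sending `X ^ k` to the basis vector with index `k mod n`. -/
noncomputable def cyclicCoeffs (n : ℕ) [NeZero n] : ℤ[X] →ₗ[ℤ] (Fin n → ℤ) :=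
  (basisMonomials ℤ).constr ℤ fun k => Pi.single (Fin.ofNat n k) 1

open Polynomial in
theorem cyclicCoeffs_X_pow (n : ℕ) [NeZero n] (k : ℕ) :
    cyclicCoeffs n (X ^ k) = Pi.single (Fin.ofNat n k) 1 := by
  have h : (X ^ k : ℤ[X]) = basisMonomials ℤ k := by simp [X_pow_eq_monomial]
  rw [h, cyclicCoeffs, Module.Basis.constr_basis]

/-- The linear map `ℤⁿ → A` sending `v` to `∑ j, v j * x ^ j`. -/
noncomputable def cyclicEval {A : Type*} [CommRing A] (n : ℕ) (x : A) : (Fin n → ℤ) →ₗ[ℤ] A :=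
  Fintype.linearCombination ℤ fun j : Fin n => x ^ j.val

theorem cyclicEval_single {A : Type*} [CommRing A] (n : ℕ) (x : A) (j : Fin n) :
    cyclicEval n x (Pi.single j 1) = x ^ j.val := by
  simp [cyclicEval, Fintype.linearCombination_apply_single]

open Polynomial in
theorem cyclicCoeffs_cyclicEval_X (n : ℕ) [NeZero n] (v : Fin n → ℤ) :
    cyclicCoeffs n (cyclicEval n X v) = v := by
  have : cyclicCoeffs n ∘ₗ cyclicEval n (X : ℤ[X]) = LinearMap.id := by
    ext j : 2
    simp [cyclicEval_single, cyclicCoeffs_X_pow]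
  exact LinearMap.congr_fun this v

open Polynomial in
theorem aeval_cyclicEval_X {A : Type*} [CommRing A] (n : ℕ) (x : A) (v : Fin n → ℤ) :
    aeval x (cyclicEval n (X : ℤ[X]) v) = cyclicEval n x v := by
  simp [cyclicEval, Fintype.linearCombination_apply]

open Polynomial in
theorem cyclicEval_cyclicCoeffs {A : Type*} [CommRing A] (n : ℕ) [NeZero n] {x : A}
    (hx : x ^ n = 1) (P : ℤ[X]) : cyclicEval n x (cyclicCoeffs n P) = aeval x P := by
  have : cyclicEval n x ∘ₗ cyclicCoeffs n = (aeval x).toLinearMap := by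
    refine (basisMonomials ℤ).ext fun k => ?_
    simp only [coe_basisMonomials, ← X_pow_eq_monomial]
    simp [cyclicEval_single, cyclicCoeffs_X_pow, ← pow_eq_pow_mod k hx]
  exact LinearMap.congr_fun this P

open Polynomial in
theorem cyclicCoeffs_mul_X_pow_sub_one (n : ℕ) [NeZero n] (P : ℤ[X]) :
    cyclicCoeffs n (P * (X ^ n - 1)) = 0 := by
  induction P using Polynomial.induction_on' with
  | add P Q hP hQ => rw [add_mul, map_add, hP, hQ, add_zero]
  | monomial k c =>
    rw [← C_mul_X_pow_eq_monomial, ← smul_eq_C_mul, smul_mul_assoc, map_smul, mul_sub, mul_one,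
      ← pow_add, map_sub, cyclicCoeffs_X_pow, cyclicCoeffs_X_pow]
    simp [Fin.ofNat]

theorem succ_mod_eq_ite {n : ℕ} (k : ℕ) (hn : 2 ≤ n) :
    (k + 1) % n = if k % n + 1 = n then 0 else k % n + 1 := by
  rw [Nat.add_mod, Nat.mod_eq_of_lt (show 1 < n by omega)]
  have := Nat.mod_lt k (show 0 < n by omega)
  split_ifs with h
  · simp [h]
  · exact Nat.mod_eq_of_lt (by omega)

theorem toLin'_Cmat_transpose_single {n : ℕ} [NeZero n] (hn : 3 ≤ n) (a b : ℤ) (k : ℕ) :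
    Matrix.toLin' (Cmat n a b)ᵀ (Pi.single (Fin.ofNat n (k + 1)) 1) =
      a • Pi.single (Fin.ofNat n (k + 1)) 1 + b • Pi.single (Fin.ofNat n k) 1 +
        b • Pi.single (Fin.ofNat n (k + 2)) 1 := by
  ext i
  have hk := Nat.mod_lt k (show 0 < n by omega)
  have h₁ := succ_mod_eq_ite k (show 2 ≤ n by omega)
  have h₂ := succ_mod_eq_ite (k + 1) (show 2 ≤ n by omega)
  have h₃ := succ_mod_eq_ite ((k + 1) % n) (show 2 ≤ n by omega)
  have h₄ := succ_mod_eq_ite i.val (show 2 ≤ n by omega)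
  have hi := i.isLt
  rw [Nat.mod_mod] at h₃
  rw [Nat.mod_eq_of_lt hi] at h₄
  simp only [toLin'_apply, mulVec_single_one, col_apply, transpose_apply, Cmat, of_apply,
    Fin.ext_iff, Fin.ofNat, Pi.add_apply, Pi.smul_apply, Pi.single_apply, smul_eq_mul, h₃, h₄]
  rw [show k + 2 = k + 1 + 1 from rfl, h₂, h₁]
  generalize k % n = j at *
  split_ifs <;> first | omega | (simp; done) | (simp only [or_false] at *; omega)

open Polynomial in
theorem toLin'_Cmat_transpose_cyclicCoeffs {n : ℕ} [NeZero n] (hn : 3 ≤ n) (a l : ℤ) (P : ℤ[X]) :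
    Matrix.toLin' (Cmat n a (-l))ᵀ (cyclicCoeffs n (P * X)) =
      -cyclicCoeffs n (P * (C l * X ^ 2 - C a * X + C l)) := by
  induction P using Polynomial.induction_on' with
  | add P Q hP hQ => rw [add_mul, add_mul, map_add, map_add, map_add, hP, hQ, neg_add]
  | monomial k c =>
    have h : X ^ k * (C l * X ^ 2 - C a * X + C l) =
        l • X ^ (k + 2) - a • X ^ (k + 1) + l • X ^ k := by
      simp only [smul_eq_C_mul]
      ring
    rw [← C_mul_X_pow_eq_monomial, ← smul_eq_C_mul, smul_mul_assoc, smul_mul_assoc, h, ← pow_succ]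
    simp only [map_smul, map_add, map_sub, cyclicCoeffs_X_pow,
      toLin'_Cmat_transpose_single hn]
    module

/-- The ideal `(N, s·ω)` of `ℤ[ω]` with `ω² = c + c·ω`, when `s ∣ N` and `N ∣ s·c`. -/
def quadraticIdeal (c N s : ℤ) (hN : s ∣ N) (hc : N ∣ s * c) : Ideal (QuadraticAlgebra ℤ c c) where
  carrier := {z | N ∣ z.re ∧ s ∣ z.im}
  zero_mem' := by simp
  add_mem' hx hy := ⟨dvd_add hx.1 hy.1, dvd_add hx.2 hy.2⟩
  smul_mem' z w := by
    rintro ⟨h₁, h₂⟩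
    simp only [smul_eq_mul, Set.mem_ofPred_eq, QuadraticAlgebra.re_mul, QuadraticAlgebra.im_mul]
    have h₃ : s ∣ w.re := hN.trans h₁
    constructor
    · refine dvd_add (h₁.mul_left _) ?_
      obtain ⟨t, ht⟩ := h₂
      exact hc.trans ⟨z.im * t, by rw [ht]; ring⟩
    · exact dvd_add (dvd_add (h₂.mul_left _) (h₃.mul_left _)) (h₂.mul_left _)

open Polynomial QuadraticAlgebra in
/-- The coordinates of `∑ j, v j * (1 + ω) ^ j` decide membership in the row lattice of
`C_n(m + 2l, -l)` when `l` and `m` are coprime. -/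
theorem mem_range_toLin'_Cmat_iff {m l e u : ℤ} {n q : ℕ} [NeZero n] (hn : n = 2 * q + 3) {s : ℤ}
    (hs : s = fseq (m + 2 * l) (-l) (q + 1) + l * fseq (m + 2 * l) (-l) q)
    (he : e * l + u * (m * s) = 1) (v : Fin n → ℤ) :
    v ∈ LinearMap.range (Matrix.toLin' (Cmat n (m + 2 * l) (-l))ᵀ) ↔
      s ∣ (cyclicEval n (1 + QuadraticAlgebra.omega :
          QuadraticAlgebra ℤ (m * e) (m * e)) v).im ∧
        m * s ∣ (cyclicEval n (1 + QuadraticAlgebra.omega :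
          QuadraticAlgebra ℤ (m * e) (m * e)) v).re := by
  set p : ℤ[X] := C l * X ^ 2 - C (m + 2 * l) * X + C l with hp
  constructor
  · rintro ⟨w, rfl⟩
    let L := quadraticIdeal (m * e) (m * s) s ⟨m, mul_comm _ _⟩ ⟨e, by ring⟩
    let mk := Ideal.Quotient.mk L
    suffices h : mk (cyclicEval n (1 + QuadraticAlgebra.omega)
        (Matrix.toLin' (Cmat n (m + 2 * l) (-l))ᵀ w)) = 0 by
      exact ((Ideal.Quotient.eq_zero_iff_mem).1 h).symm
    set x := mk (1 + QuadraticAlgebra.omega) with hx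
    have hmk (v) : mk (cyclicEval n (1 + QuadraticAlgebra.omega) v) = cyclicEval n x v := by
      simp [cyclicEval, Fintype.linearCombination_apply, hx]
    have hms : ((m * s : ℤ) : QuadraticAlgebra ℤ (m * e) (m * e) ⧸ L) = 0 := by
      rw [← map_intCast mk]
      exact Ideal.Quotient.eq_zero_iff_mem.2 ⟨by simp, by simp⟩
    have hsx : (s : QuadraticAlgebra ℤ (m * e) (m * e) ⧸ L) * (x - 1) = 0 := by
      rw [← map_intCast mk, hx, ← map_one mk, ← map_sub, ← map_mul]
      exact Ideal.Quotient.eq_zero_iff_mem.2 ⟨by simp, by simp⟩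
    have hx2 : x ^ 2 - (2 + m * e) * x + 1 = 0 := by
      have : (1 + QuadraticAlgebra.omega : QuadraticAlgebra ℤ (m * e) (m * e)) ^ 2 -
          ((2 + m * e : ℤ) : QuadraticAlgebra ℤ (m * e) (m * e)) *
            (1 + QuadraticAlgebra.omega) + 1 = 0 := by
        ext <;> simp [pow_two]
      simpa [hx, map_ofNat mk] using congrArg mk this
    have hel : (e : QuadraticAlgebra ℤ (m * e) (m * e) ⧸ L) * l = 1 := by
      have := congrArg (Int.cast : ℤ → QuadraticAlgebra ℤ (m * e) (m * e) ⧸ L) he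
      rw [Int.cast_add, Int.cast_mul u, hms] at this
      simpa using this
    have hpx : (l : QuadraticAlgebra ℤ (m * e) (m * e) ⧸ L) * x ^ 2 - (m + 2 * l) * x + l = 0 := by
      linear_combination l * hx2 + m * x * hel
    have hxn : x ^ n = 1 := by
      have h := fseq_add_mul_fseq_mul_pow_mul hpx q
      have hs' := congrArg (Int.cast : ℤ → QuadraticAlgebra ℤ (m * e) (m * e) ⧸ L) hs
      push_cast [intCast_fseq] at hs'
      rw [← hs', ← hn] at h
      have h₁ : (e * l : QuadraticAlgebra ℤ (m * e) (m * e) ⧸ L) ^ (q + 1) * (x ^ n - 1) = 0 := by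
        rw [mul_pow]
        linear_combination e ^ (q + 1) * x ^ (q + 1) * hsx - e ^ (q + 1) * h
      rw [hel, one_pow, one_mul] at h₁
      exact sub_eq_zero.1 h₁
    rw [hmk]
    have hw : w = cyclicCoeffs n (cyclicEval n X w * X ^ (n - 1) * X) := by
      have h := cyclicCoeffs_mul_X_pow_sub_one n (cyclicEval n X w)
      rw [mul_sub, map_sub, mul_one, cyclicCoeffs_cyclicEval_X, sub_eq_zero] at h
      rw [mul_assoc, ← pow_succ, Nat.sub_add_cancel (by omega)]
      exact h.symm
    rw [hw, toLin'_Cmat_transpose_cyclicCoeffs (by omega), map_neg, cyclicEval_cyclicCoeffs n hxn,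
      map_mul, neg_eq_zero]
    refine mul_eq_zero_of_right _ ?_
    simpa [map_ofNat (aeval x)] using hpx
  · rintro ⟨h₁, h₂⟩
    let I : Ideal ℤ[X] := Ideal.span {X ^ n - 1, p}
    let mk := Ideal.Quotient.mk I
    set x := mk X with hx
    have hI (P) (hP : P ∈ I) :
        cyclicCoeffs n P ∈ LinearMap.range (Matrix.toLin' (Cmat n (m + 2 * l) (-l))ᵀ) := by
      obtain ⟨A, B, rfl⟩ := Ideal.mem_span_pair.1 hP
      rw [map_add, cyclicCoeffs_mul_X_pow_sub_one, zero_add]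
      exact ⟨-cyclicCoeffs n (B * X), by
        rw [map_neg, toLin'_Cmat_transpose_cyclicCoeffs (by omega), neg_neg]⟩
    have hxn : x ^ n = 1 := by
      have : mk (X ^ n - 1) = 0 :=
        Ideal.Quotient.eq_zero_iff_mem.2 (Ideal.subset_span (by simp))
      simpa [sub_eq_zero] using this
    have hpx : (l : ℤ[X] ⧸ I) * x ^ 2 - (m + 2 * l) * x + l = 0 := by
      have : mk p = 0 := Ideal.Quotient.eq_zero_iff_mem.2 (Ideal.subset_span (by simp))
      simpa [hp, map_ofNat mk] using this
    have hxu : x ^ (n - 1) * x = 1 := by rw [← pow_succ, Nat.sub_add_cancel (by omega), hxn]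
    have hsx : (s : ℤ[X] ⧸ I) * (x - 1) = 0 := by
      have h := fseq_add_mul_fseq_mul_pow_mul hpx q
      have hs' := congrArg (Int.cast : ℤ → ℤ[X] ⧸ I) hs
      push_cast [intCast_fseq] at hs'
      rw [← hs', ← hn, hxn, sub_self, mul_zero] at h
      have h' : (x ^ (n - 1) * x) ^ (q + 1) * ((s : ℤ[X] ⧸ I) * (x - 1)) = 0 := by
        rw [mul_pow]
        linear_combination (x ^ (n - 1)) ^ (q + 1) * h
      rwa [hxu, one_pow, one_mul] at h'
    have hms : (m : ℤ[X] ⧸ I) * s = 0 := by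
      linear_combination x ^ (n - 1) * l * (x - 1) * hsx - s * x ^ (n - 1) * hpx - m * s * hxu
    have hel : (e : ℤ[X] ⧸ I) * l = 1 := by
      have := congrArg (Int.cast : ℤ → ℤ[X] ⧸ I) he
      push_cast at this
      rwa [hms, mul_zero, add_zero] at this
    have hω : (x - 1) * (x - 1) =
        (m * e : ℤ) • (1 : ℤ[X] ⧸ I) + (m * e : ℤ) • (x - 1) := by
      rw [zsmul_eq_mul, zsmul_eq_mul]
      push_cast
      linear_combination e * hpx - (x - 1) ^ 2 * hel
    let f := QuadraticAlgebra.lift (R := ℤ) ⟨x - 1, hω⟩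
    have hf (P : ℤ[X]) : f (aeval (1 + QuadraticAlgebra.omega) P) = mk P := by
      have h : f.comp (aeval (1 + QuadraticAlgebra.omega)) = Ideal.Quotient.mkₐ ℤ I := by
        ext
        simp [f, hx, mk, QuadraticAlgebra.lift]
      exact DFunLike.congr_fun h P
    rw [← cyclicCoeffs_cyclicEval_X n v]
    apply hI
    rw [← Ideal.Quotient.eq_zero_iff_mem]
    change mk _ = 0
    rw [← hf, aeval_cyclicEval_X]
    obtain ⟨α, hα⟩ := h₁
    obtain ⟨β, hβ⟩ := h₂
    simp only [f, QuadraticAlgebra.lift, Equiv.coe_fn_mk, AlgHom.coe_mk, RingHom.coe_mk,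
      MonoidHom.coe_mk, OneHom.coe_mk]
    rw [hα, hβ, zsmul_eq_mul, zsmul_eq_mul]
    push_cast
    linear_combination β * hms + α * hsx

/-- Let `n ≥ 4` with `n - 2 = 2q + 1` odd, `r = gcd(l,m)`, and let `s` be the
integer with `r^(q+1)·s = f_{q+1}(m+2l, -l) + l·f_q(m+2l, -l)`.  The critical
group of the `m`-cone of `C_n(l)`, i.e. the cokernel `ℤⁿ / C_n(m+2l, -l)ᵀ ℤⁿ`,
is isomorphic to `(ℤ_r)^(n-2) ⊕ ℤ_{r·s} ⊕ ℤ_{m·s}`. -/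
theorem criticalGroup_cone_cycle_odd (m l n q : ℕ) (hl : 1 ≤ l) (hn : 4 ≤ n)
    (hq : n - 2 = 2 * q + 1) (s : ℤ)
    (hs : (Nat.gcd l m : ℤ) ^ (q + 1) * s =
        fseq ((m : ℤ) + 2 * l) (-(l : ℤ)) (q + 1) +
          l * fseq ((m : ℤ) + 2 * l) (-(l : ℤ)) q) :
    Nonempty
      (((Fin n → ℤ) ⧸
          LinearMap.range (Matrix.toLin' (Cmat n ((m : ℤ) + 2 * l) (-(l : ℤ)))ᵀ)) ≃+
        ((Fin (n - 2) → ZMod (Nat.gcd l m)) ×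
          ZMod (((Nat.gcd l m : ℤ) * s).natAbs) × ZMod ((m * s).natAbs))) := by
  obtain rfl : n = 2 * q + 3 := by omega
  obtain ⟨r, l', m', hr, hcop, rfl, rfl⟩ : ∃ r l' m' : ℕ, 0 < r ∧ Nat.Coprime l' m' ∧
      l = r * l' ∧ m = r * m' := by
    have hr : 0 < Nat.gcd l m := Nat.gcd_pos_of_pos_left _ hl
    exact ⟨_, _, _, hr, Nat.coprime_div_gcd_div_gcd hr,
      (Nat.mul_div_cancel' (Nat.gcd_dvd_left l m)).symm,
      (Nat.mul_div_cancel' (Nat.gcd_dvd_right l m)).symm⟩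
  rw [Nat.gcd_mul_left, hcop.gcd_eq_one, mul_one] at hs ⊢
  have hr₀ : (r : ℤ) ≠ 0 := by exact_mod_cast hr.ne'
  have ha : ((r * m' : ℕ) : ℤ) + 2 * (r * l' : ℕ) = r * (m' + 2 * l') := by push_cast; ring
  have hb : -((r * l' : ℕ) : ℤ) = r * -l' := by push_cast; ring
  rw [ha, hb] at hs ⊢
  have hs' : s = fseq ((m' : ℤ) + 2 * l') (-l') (q + 1) + l' * fseq ((m' : ℤ) + 2 * l') (-l') q := by
    rw [fseq_mul_mul, fseq_mul_mul] at hs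
    apply mul_left_cancel₀ (pow_ne_zero (q + 1) hr₀)
    rw [hs]
    push_cast
    ring
  obtain ⟨e, u, he⟩ : IsCoprime (l' : ℤ) (m' * s) :=
    hs' ▸ isCoprime_mul_fseq_add (Nat.isCoprime_iff_coprime.2 hcop) q
  let ψ := cyclicEval (2 * q + 3) (1 + QuadraticAlgebra.omega :
    QuadraticAlgebra ℤ ((m' : ℤ) * e) (m' * e))
  let φ : (Fin (2 * q + 3) → ℤ) →ₗ[ℤ] ℤ × ℤ :=
    { toFun v := ((ψ v).im, (ψ v).re)
      map_add' v w := by simp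
      map_smul' c v := by rw [map_smul]; rfl }
  have hφ : Function.Surjective φ := by
    rintro ⟨y, z⟩
    refine ⟨(z - y) • Pi.single 0 1 + y • Pi.single 1 1, ?_⟩
    simp only [φ, ψ, LinearMap.coe_mk, AddHom.coe_mk, map_add, map_smul, cyclicEval_single]
    ext <;> simp [QuadraticAlgebra.re_one, QuadraticAlgebra.im_one]
  have hC : Cmat (2 * q + 3) ((r : ℤ) * (m' + 2 * l')) (r * -l') =
      (r : ℤ) • Cmat (2 * q + 3) ((m' : ℤ) + 2 * l') (-l') := by
    ext i j
    simp only [Cmat, of_apply, Matrix.smul_apply, smul_eq_mul]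
    split_ifs <;> simp
  have key := nonempty_quotient_smul_addEquiv (r := r) φ hφ _
    (LinearMap.range (Matrix.toLin' (Cmat (2 * q + 3) ((r : ℤ) * (m' + 2 * l')) (r * -l'))ᵀ))
    (mem_range_toLin'_Cmat_iff rfl hs' he) fun v => by
      rw [hC, transpose_smul, map_smul]
      simp [LinearMap.mem_range, eq_comm]
  have hms : ((r * m' : ℕ) : ℤ) * s = r * (m' * s) := by push_cast; ring
  rw [hms]
  exact key
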